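/- Let p be a prime and let f be a binary form of degree N over ℤ_p with nonzero discriminant. Then the set {(A,B) ∈ W_N^0(ℤ_p) : inv(A,B) = f and λ(A,B) is a unit in ℤ_p} is nonempty and G_N(ℤ_p) acts transitively on it, and the stabilizer in G_N(ℤ_p) of any element of this set is trivial. -/

import Mathlib

open Matrix MvPolynomial

/-- Pairs of `N × N` matrices over `R`, with `N = 2n+1`. -/
abbrev MPair (n : ℕ) (R : Type*) : Type _ :=
  Matrix (Fin (2*n+1)) (Fin (2*n+1)) R × Matrix (Fin (2*n+1)) (Fin (2*n+1)) R

/-- The action of a matrix `g` on a pair: `g • (A, B) = (g A gᵀ, g B gᵀ)`. -/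
def actPair {R : Type*} [CommRing R] {m : ℕ} (g : Matrix (Fin m) (Fin m) R)
    (w : Matrix (Fin m) (Fin m) R × Matrix (Fin m) (Fin m) R) :
    Matrix (Fin m) (Fin m) R × Matrix (Fin m) (Fin m) R :=
  (g * w.1 * g.transpose, g * w.2 * g.transpose)

/-- Membership in `W_N(R)`: both matrices are symmetric. -/
def WNmem {R : Type*} [CommRing R] (n : ℕ) (w : MPair n R) : Prop := w.1.IsSymm ∧ w.2.IsSymm

/-- The inclusion `Fin n → Fin (2n+1)` of the first `n` indices. -/
def rowIdx (n : ℕ) (i : Fin n) : Fin (2*n+1) := Fin.castLE (by omega) i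

/-- The inclusion `Fin (n+1) → Fin (2n+1)` of the last `n+1` indices. -/
def colIdx (n : ℕ) (j : Fin (n+1)) : Fin (2*n+1) :=
  Fin.cast (by omega) (Fin.natAdd n j)

/-- The coefficient of `x^{N-i} y^i` in a binary `N`-ic form (written in
`MvPolynomial (Fin 2) R`, where variable `0` is `x` and variable `1` is `y`). -/
noncomputable def formCoeff {R : Type*} [CommRing R] (f : MvPolynomial (Fin 2) R) (N i : ℕ) : R :=
  MvPolynomial.coeff (Finsupp.single (0 : Fin 2) (N - i) + Finsupp.single (1 : Fin 2) i) f

/-- The `λ`-invariant of a pair `(A,B)`, computed from the top-right `n × (n+1)` blocks: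
the determinant of the `(n+1) × (n+1)` matrix whose `(i,j)` entry (0-indexed) is `(-1)^i`
times the coefficient of `x^{n-j} y^j` in `det(x A^{(i)} - y B^{(i)})`, where `A^{(i)}`,
`B^{(i)}` are obtained from the top-right `n × (n+1)` blocks by deleting the `i`-th column. -/
noncomputable def lambdaInv {R : Type*} [CommRing R] (n : ℕ) (w : MPair n R) : R :=
  Matrix.det (Matrix.of fun i j : Fin (n+1) =>
    (-1 : R) ^ (i : ℕ) *
      formCoeff
        (Matrix.det (Matrix.of fun r c : Fin n =>
          MvPolynomial.X 0 * MvPolynomial.C (w.1 (rowIdx n r) (colIdx n (i.succAbove c))) -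
          MvPolynomial.X 1 * MvPolynomial.C (w.2 (rowIdx n r) (colIdx n (i.succAbove c)))))
        n (j : ℕ))
/-- Membership in `W_N^0(R)`: symmetric pairs vanishing on the top-left `n × n` block. -/
def W0mem {R : Type*} [CommRing R] (n : ℕ) (w : MPair n R) : Prop :=
  WNmem n w ∧ ∀ i j : Fin (2*n+1), (i : ℕ) < n → (j : ℕ) < n → w.1 i j = 0 ∧ w.2 i j = 0

/-- Membership in `G_N(R) ⊆ SL_N(R)`: determinant one and vanishing top-right `n × (n+1)`
block (1-indexed: `g_{ij} = 0` whenever `i ≤ n` and `j ≥ n+1`). -/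
def GNmem {R : Type*} [CommRing R] (n : ℕ) (g : Matrix (Fin (2*n+1)) (Fin (2*n+1)) R) : Prop :=
  g.det = 1 ∧ ∀ i j : Fin (2*n+1), (i : ℕ) < n → n ≤ (j : ℕ) → g i j = 0

/-- `inv(A,B) = (-1)^n det(x A - y B)`, a binary `N`-ic form realized in
`MvPolynomial (Fin 2) R` (variable `0` is `x`, variable `1` is `y`). -/
noncomputable def invForm {R : Type*} [CommRing R] (n : ℕ) (w : MPair n R) :
    MvPolynomial (Fin 2) R :=
  (-1) ^ n *
    Matrix.det (Matrix.of fun i j : Fin (2*n+1) =>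
      MvPolynomial.X 0 * MvPolynomial.C (w.1 i j) - MvPolynomial.X 1 * MvPolynomial.C (w.2 i j))

/-! ### Determinants of bordered block matrices -/

/-- If `v` is in the kernel of the `n × (n+1)` matrix `(L | a)`, then the determinant of the
symmetric block matrix with blocks `0, (L | a), (L | a)ᵀ, S` is, up to explicit factors,
the value `v ⬝ᵥ S *ᵥ v`. -/
lemma sq_mul_det_fromBlocks_zero_fromCols {R ι : Type*} [CommRing R] [Fintype ι] [DecidableEq ι]
    (L : Matrix ι ι R) (a : Matrix ι Unit R) (S : Matrix (ι ⊕ Unit) (ι ⊕ Unit) R)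
    (v : ι ⊕ Unit → R) (hv : fromCols L a *ᵥ v = 0) :
    v (Sum.inr ()) ^ 2 * det (fromBlocks 0 (fromCols L a) (fromCols L a)ᵀ S) =
      (-1) ^ Fintype.card ι * det L ^ 2 * (v ⬝ᵥ S *ᵥ v) := by
  set Q : Matrix (ι ⊕ Unit) (ι ⊕ Unit) R :=
    fromBlocks 1 (of fun i _ => v (Sum.inl i)) 0 (of fun _ _ => v (Sum.inr ())) with hQ
  have hQcol : ∀ i, Q i (Sum.inr ()) = v i := by
    rintro (i | i) <;> simp [hQ]
  have hQdet : det Q = v (Sum.inr ()) := by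
    simp [hQ, det_fromBlocks_zero₂₁]
  have hMQ : fromCols L a * Q = fromCols L 0 := by
    ext i j
    rcases j with j | j
    · simp [Matrix.mul_apply, hQ, fromCols, Matrix.one_apply]
    · have := congrFun hv i
      simp only [Matrix.mulVec, dotProduct] at this
      simp only [Matrix.mul_apply, hQcol]
      simpa using this
  set Y := Qᵀ * S * Q with hY
  have hYq : Y (Sum.inr ()) (Sum.inr ()) = v ⬝ᵥ S *ᵥ v := by
    rw [hY, Matrix.mul_assoc, Matrix.mul_apply]
    simp only [transpose_apply, hQcol, dotProduct, Matrix.mulVec, Matrix.mul_apply]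
  have hconj : (fromBlocks 1 0 0 Q)ᵀ * fromBlocks 0 (fromCols L a) (fromCols L a)ᵀ S *
      fromBlocks 1 0 0 Q = fromBlocks (0 : Matrix ι ι R) (fromCols L 0) (fromCols L 0)ᵀ Y := by
    rw [← hMQ]
    simp [fromBlocks_transpose, fromBlocks_multiply, transpose_mul, hY]
  have h1 : det (fromBlocks (0 : Matrix ι ι R) (fromCols L 0) (fromCols L 0)ᵀ Y) =
      v (Sum.inr ()) ^ 2 * det (fromBlocks 0 (fromCols L a) (fromCols L a)ᵀ S) := by
    rw [← hconj, det_mul, det_mul, det_transpose, det_fromBlocks_zero₂₁, det_one, hQdet]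
    ring
  have hswap : det (fromBlocks (0 : Matrix ι ι R) (fromCols (1 : Matrix ι ι R) (0 : Matrix ι Unit R))
      (fromRows (1 : Matrix ι ι R) (0 : Matrix Unit ι R)) 1 *
      fromBlocks 1 (fromCols (-1 : Matrix ι ι R) (0 : Matrix ι Unit R)) 0 1) =
      (-1) ^ Fintype.card ι := by
    rw [det_mul, det_fromBlocks_one₂₂, det_fromBlocks_zero₂₁, fromCols_mul_fromRows]
    simp [det_neg]
  have hprod : fromBlocks (0 : Matrix ι ι R) (fromCols L 0) (fromCols L 0)ᵀ Y *
      (fromBlocks (0 : Matrix ι ι R) (fromCols (1 : Matrix ι ι R) (0 : Matrix ι Unit R))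
      (fromRows (1 : Matrix ι ι R) (0 : Matrix Unit ι R)) 1 *
      fromBlocks 1 (fromCols (-1 : Matrix ι ι R) (0 : Matrix ι Unit R)) 0 1) =
      fromBlocks L 0 (fromRows Y.toBlocks₁₁ Y.toBlocks₂₁)
        (fromBlocks Lᵀ Y.toBlocks₁₂ 0 Y.toBlocks₂₂) := by
    rw [← fromBlocks_toBlocks Y]
    ext (i | i | i) (j | j | j) <;>
    simp [Matrix.mul_apply, Matrix.one_apply]
  have h2 := congrArg det hprod
  rw [det_mul, hswap, h1, det_fromBlocks_zero₁₂, det_fromBlocks_zero₂₁, det_transpose,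
    det_unique Y.toBlocks₂₂] at h2
  have h3 : Y.toBlocks₂₂ default default = v ⬝ᵥ S *ᵥ v := hYq
  rw [h3] at h2
  have h4 : ((-1 : R) ^ Fintype.card ι) * (-1) ^ Fintype.card ι = 1 := by
    rw [← mul_pow]; simp
  linear_combination (-1 : R) ^ Fintype.card ι * h2 -
    (v (Sum.inr ()) ^ 2 * det (fromBlocks 0 (fromCols L a) (fromCols L a)ᵀ S)) * h4

/-! ### Binary forms -/

section BinaryForms

variable {R : Type*} [CommRing R]

/-- The exponent of the monomial `x^{N-k} y^k`. -/
noncomputable def formExp (N k : ℕ) : Fin 2 →₀ ℕ :=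
  Finsupp.single (0 : Fin 2) (N - k) + Finsupp.single (1 : Fin 2) k

lemma formExp_inj {N j k : ℕ} : formExp N j = formExp N k ↔ j = k := by
  refine ⟨fun h => ?_, fun h => h ▸ rfl⟩
  have := DFunLike.congr_fun h 1
  simpa [formExp] using this

lemma formCoeff_monomial (N j k : ℕ) (c : R) :
    formCoeff (monomial (formExp N k) c) N j = if k = j then c else 0 := by
  unfold formCoeff
  rw [coeff_monomial]
  exact if_congr formExp_inj rfl rfl

lemma formCoeff_sub (p q : MvPolynomial (Fin 2) R) (N j : ℕ) :
    formCoeff (p - q) N j = formCoeff p N j - formCoeff q N j := coeff_sub _ _ _ _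

lemma formCoeff_sum {ι : Type*} (s : Finset ι) (p : ι → MvPolynomial (Fin 2) R) (N j : ℕ) :
    formCoeff (∑ i ∈ s, p i) N j = ∑ i ∈ s, formCoeff (p i) N j := coeff_sum _ _ _

lemma formCoeff_C_mul (c : R) (p : MvPolynomial (Fin 2) R) (N j : ℕ) :
    formCoeff (C c * p) N j = c * formCoeff p N j := coeff_C_mul _ _ _

/-- The monomial `x^{N-k} y^k`. -/
noncomputable def formMonomial (R : Type*) [CommRing R] (N k : ℕ) : MvPolynomial (Fin 2) R :=
  X 0 ^ (N - k) * X 1 ^ k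

lemma C_mul_formMonomial (N k : ℕ) (c : R) :
    C c * formMonomial R N k = monomial (formExp N k) c := by
  rw [formMonomial, formExp, X_pow_eq_monomial, X_pow_eq_monomial, monomial_mul, C_mul_monomial]
  simp

lemma form_ext {N : ℕ} {p q : MvPolynomial (Fin 2) R} (hp : p.IsHomogeneous N)
    (hq : q.IsHomogeneous N) (h : ∀ k ≤ N, formCoeff p N k = formCoeff q N k) : p = q := by
  ext d
  by_cases hd : d.degree = N
  · have h2 : d 0 + d 1 = N := by
      rw [← hd, Finsupp.degree_eq_sum, Fin.sum_univ_two]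
    have h3 : d = formExp N (d 1) := by
      ext i
      fin_cases i
      · simp [formExp]; omega
      · simp [formExp]
    rw [h3]
    exact h _ (by omega)
  · rw [hp.coeff_eq_zero hd, hq.coeff_eq_zero hd]

lemma formMonomial_isHomogeneous {N k : ℕ} (hk : k ≤ N) :
    (formMonomial R N k).IsHomogeneous N := by
  have := (isHomogeneous_X_pow (R := R) (0 : Fin 2) (N - k)).mul (isHomogeneous_X_pow 1 k)
  rwa [Nat.sub_add_cancel hk] at this

/-- A binary form is the sum of its monomials. -/
lemma form_eq_sum {N : ℕ} {p : MvPolynomial (Fin 2) R} (hp : p.IsHomogeneous N) :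
    p = ∑ k : Fin (N + 1), C (formCoeff p N k) * formMonomial R N k := by
  refine form_ext hp (IsHomogeneous.sum _ _ _ fun k _ => ?_) fun k hk => ?_
  · simpa using (isHomogeneous_C (Fin 2) (formCoeff p N k)).mul
      (formMonomial_isHomogeneous (R := R) (Nat.lt_succ_iff.mp k.2))
  · simp only [formCoeff_sum, C_mul_formMonomial, formCoeff_monomial]
    rw [Finset.sum_eq_single (⟨k, Nat.lt_succ_of_le hk⟩ : Fin (N + 1))]
    · simp
    · intro b _ hb
      rw [if_neg fun h => hb (Fin.ext h)]
    · simp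

lemma X_zero_mul_formMonomial {N k : ℕ} (hk : k ≤ N) :
    X 0 * formMonomial R N k = formMonomial R (N + 1) k := by
  rw [formMonomial, formMonomial, Nat.succ_sub hk, pow_succ]
  ring

lemma X_one_mul_formMonomial (N k : ℕ) :
    X 1 * formMonomial R N k = formMonomial R (N + 1) (k + 1) := by
  rw [formMonomial, formMonomial, Nat.add_sub_add_right]
  ring

/-- The relations between coefficients expressed by a linear syzygy of the monomials
of degree `n`. -/
lemma coeff_of_linear_syzygy {n : ℕ} (a b : Fin (n + 1) → R)
    (h : ∑ k, (X 0 * C (a k) - X 1 * C (b k)) * formMonomial R n k = 0) :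
    a 0 = 0 ∧ b (Fin.last n) = 0 ∧ ∀ k : Fin n, a k.succ = b k.castSucc := by
  have key : ∀ j : ℕ, ((∑ k : Fin (n + 1), if (k : ℕ) = j then a k else 0) -
      ∑ k : Fin (n + 1), if (k : ℕ) + 1 = j then b k else 0) = 0 := by
    intro j
    have h2 : ∀ k : Fin (n + 1), (X 0 * C (a k) - X 1 * C (b k)) * formMonomial R n k =
        monomial (formExp (n + 1) k) (a k) - monomial (formExp (n + 1) (k + 1)) (b k) := by
      intro k
      rw [← C_mul_formMonomial, ← C_mul_formMonomial, ← X_one_mul_formMonomial,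
        ← X_zero_mul_formMonomial (Nat.lt_succ_iff.mp k.2)]
      ring
    have h3 := congrArg (fun q => formCoeff q (n + 1) j) h
    simp only [h2, formCoeff_sum, formCoeff_sub, formCoeff_monomial,
      Finset.sum_sub_distrib] at h3
    rw [h3]
    simp [formCoeff]
  refine ⟨?_, ?_, fun k => ?_⟩
  · have := key 0
    simpa [← Fin.ext_iff, Fin.val_eq_zero_iff] using this
  · have := key (n + 1)
    rw [Finset.sum_eq_zero fun k _ => if_neg k.2.ne,
      Finset.sum_eq_single (Fin.last n)
        (fun b _ hb => if_neg fun h => hb (Fin.ext (by simpa using h))) (by simp)] at this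
    simpa using this
  · have := key (k + 1)
    rw [Finset.sum_eq_single k.succ (fun b _ hb => if_neg fun h => hb (Fin.ext (by simpa using h)))
        (by simp),
      Finset.sum_eq_single k.castSucc
        (fun b _ hb => if_neg fun h => hb (Fin.ext (by simpa using h))) (by simp)] at this
    simpa [sub_eq_zero] using this

end BinaryForms

/-! ### Pencils of matrices and their maximal minors -/

section Pencil

variable {R : Type*} [CommRing R]

/-- The matrix of linear forms `x A - y B`. -/
noncomputable def pencil {l m : Type*} (A B : Matrix l m R) :
    Matrix l m (MvPolynomial (Fin 2) R) :=
  of fun i j => X 0 * C (A i j) - X 1 * C (B i j)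

/-- A matrix of scalars, seen as a matrix of constant polynomials. -/
noncomputable def constMat {l m : Type*} (P : Matrix l m R) :
    Matrix l m (MvPolynomial (Fin 2) R) :=
  of fun i j => C (P i j)

lemma pencil_mul_left {k l m : Type*} [Fintype l] (P : Matrix k l R) (A B : Matrix l m R) :
    pencil (P * A) (P * B) = constMat P * pencil A B := by
  ext1 i j
  simp only [pencil, constMat, of_apply, Matrix.mul_apply, map_sum, map_mul, Finset.mul_sum,
    ← Finset.sum_sub_distrib]
  exact Finset.sum_congr rfl fun _ _ => by ring

lemma pencil_mul_right {k l m : Type*} [Fintype l] (A B : Matrix k l R) (P : Matrix l m R) :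
    pencil (A * P) (B * P) = pencil A B * constMat P := by
  ext1 i j
  simp only [pencil, constMat, of_apply, Matrix.mul_apply, map_sum, map_mul, Finset.mul_sum,
    ← Finset.sum_sub_distrib]
  exact Finset.sum_congr rfl fun _ _ => by ring

lemma det_constMat {m : Type*} [Fintype m] [DecidableEq m] (P : Matrix m m R) :
    det (constMat P) = C (det P) :=
  ((C : R →+* MvPolynomial (Fin 2) R).map_det P).symm

lemma det_pencil_isHomogeneous {m : ℕ} (A B : Matrix (Fin m) (Fin m) R) :
    (det (pencil A B)).IsHomogeneous m := by
  have h : ∀ i j, (pencil A B i j).IsHomogeneous 1 := fun i j => by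
    refine IsHomogeneous.sub ?_ ?_
    · simpa using (isHomogeneous_X R (0 : Fin 2)).mul (isHomogeneous_C (Fin 2) (A i j))
    · simpa using (isHomogeneous_X R (1 : Fin 2)).mul (isHomogeneous_C (Fin 2) (B i j))
  rw [det_apply]
  refine IsHomogeneous.sum _ _ _ fun σ _ => ?_
  have hσ := IsHomogeneous.prod Finset.univ (fun i => pencil A B (σ i) i) (fun _ => 1)
    fun i _ => h (σ i) i
  simp only [Finset.sum_const, Finset.card_univ, Fintype.card_fin, smul_eq_mul, mul_one] at hσ
  rcases Int.units_eq_one_or (Equiv.Perm.sign σ) with hs | hs <;> rw [hs]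
  · simpa using hσ
  · simpa using hσ.neg

/-- The signed maximal minors of the pencil `x A - y B`. -/
noncomputable def minorVec {n : ℕ} (A B : Matrix (Fin n) (Fin (n + 1)) R) (i : Fin (n + 1)) :
    MvPolynomial (Fin 2) R :=
  C ((-1) ^ (i : ℕ)) * det ((pencil A B).submatrix id i.succAbove)

/-- The coefficients of the signed maximal minors of the pencil `x A - y B`. -/
noncomputable def minorCoeff {n : ℕ} (A B : Matrix (Fin n) (Fin (n + 1)) R) :
    Matrix (Fin (n + 1)) (Fin (n + 1)) R :=
  of fun i j => formCoeff (minorVec A B i) n j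

lemma minorVec_eq_sum {n : ℕ} (A B : Matrix (Fin n) (Fin (n + 1)) R) (i : Fin (n + 1)) :
    minorVec A B i = ∑ k : Fin (n + 1), C (minorCoeff A B i k) * formMonomial R n k := by
  refine form_eq_sum ?_
  have := (isHomogeneous_C (Fin 2) ((-1 : R) ^ (i : ℕ))).mul
    (det_pencil_isHomogeneous (A.submatrix id i.succAbove) (B.submatrix id i.succAbove))
  rwa [zero_add] at this

lemma pencil_mulVec_minorVec {n : ℕ} (A B : Matrix (Fin n) (Fin (n + 1)) R) :
    pencil A B *ᵥ minorVec A B = 0 := by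
  ext1 r
  have h := det_zero_of_row_eq (M := (of (Fin.cons (pencil A B r) (pencil A B)) :
    Matrix (Fin (n + 1)) (Fin (n + 1)) (MvPolynomial (Fin 2) R)))
    (Fin.succ_ne_zero r).symm rfl
  rw [det_succ_row_zero] at h
  rw [Pi.zero_apply, ← h]
  change ∑ j, pencil A B r j * minorVec A B j = _
  refine Finset.sum_congr rfl fun j _ => ?_
  simp only [minorVec, of_apply, map_pow, map_neg, map_one]
  rw [mul_left_comm, ← mul_assoc]
  rfl

lemma minorVec_mul_left {n : ℕ} (P : Matrix (Fin n) (Fin n) R)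
    (A B : Matrix (Fin n) (Fin (n + 1)) R) (i : Fin (n + 1)) :
    minorVec (P * A) (P * B) i = C (det P) * minorVec A B i := by
  have : (constMat P * pencil A B).submatrix id i.succAbove =
    constMat P * (pencil A B).submatrix id i.succAbove := rfl
  rw [minorVec, minorVec, pencil_mul_left, this, det_mul, det_constMat]
  ring

lemma det_minorCoeff_mul_left {n : ℕ} (P : Matrix (Fin n) (Fin n) R)
    (A B : Matrix (Fin n) (Fin (n + 1)) R) :
    det (minorCoeff (P * A) (P * B)) = det P ^ (n + 1) * det (minorCoeff A B) := by
  have : minorCoeff (P * A) (P * B) = det P • minorCoeff A B := by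
    ext i j
    simp [minorCoeff, minorVec_mul_left, formCoeff_C_mul]
  rw [this, det_smul, Fintype.card_fin]

/-! ### The standard pencil -/

/-- The first matrix of the standard pencil, whose maximal minors are the monomials. -/
def stdLeft (R : Type*) [CommRing R] (n : ℕ) : Matrix (Fin n) (Fin (n + 1)) R :=
  of fun r c => if c = r.succ then 1 else 0

/-- The second matrix of the standard pencil, whose maximal minors are the monomials. -/
def stdRight (R : Type*) [CommRing R] (n : ℕ) : Matrix (Fin n) (Fin (n + 1)) R :=
  of fun r c => if c = r.castSucc then 1 else 0

section Std

variable {n : ℕ} {m : Type*}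

lemma stdLeft_mul (H : Matrix (Fin (n + 1)) m R) (r : Fin n) (c : m) :
    (stdLeft R n * H) r c = H r.succ c := by
  simp [stdLeft, Matrix.mul_apply]

lemma stdRight_mul (H : Matrix (Fin (n + 1)) m R) (r : Fin n) (c : m) :
    (stdRight R n * H) r c = H r.castSucc c := by
  simp [stdRight, Matrix.mul_apply]

lemma mul_stdLeft_zero (K : Matrix m (Fin n) R) (r : m) :
    (K * stdLeft R n) r 0 = 0 := by
  simp [stdLeft, Matrix.mul_apply, (Fin.succ_ne_zero _).symm]

lemma mul_stdLeft_succ (K : Matrix m (Fin n) R) (r : m) (c : Fin n) :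
    (K * stdLeft R n) r c.succ = K r c := by
  simp [stdLeft, Matrix.mul_apply]

lemma mul_stdRight_last (K : Matrix m (Fin n) R) (r : m) :
    (K * stdRight R n) r (Fin.last n) = 0 := by
  simp [stdRight, Matrix.mul_apply, (Fin.castSucc_ne_last _).symm]

lemma mul_stdRight_castSucc (K : Matrix m (Fin n) R) (r : m) (c : Fin n) :
    (K * stdRight R n) r c.castSucc = K r c := by
  simp [stdRight, Matrix.mul_apply]

end Std

/-- A pencil is determined by the coefficients of its maximal minors up to left multiplication:
multiplying it by these coefficients gives a multiple of the standard pencil. -/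
lemma exists_mul_minorCoeff_eq_mul_std {n : ℕ} (A B : Matrix (Fin n) (Fin (n + 1)) R) :
    ∃ K : Matrix (Fin n) (Fin n) R,
      A * minorCoeff A B = K * stdLeft R n ∧ B * minorCoeff A B = K * stdRight R n := by
  have key : ∀ r, (A * minorCoeff A B) r 0 = 0 ∧ (B * minorCoeff A B) r (Fin.last n) = 0 ∧
      ∀ k : Fin n, (A * minorCoeff A B) r k.succ = (B * minorCoeff A B) r k.castSucc := by
    intro r
    refine coeff_of_linear_syzygy _ _ ?_
    have h := congrFun (pencil_mulVec_minorVec A B) r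
    have hv : minorVec A B =
        constMat (minorCoeff A B) *ᵥ (fun k : Fin (n + 1) => formMonomial R n k) :=
      funext fun i => minorVec_eq_sum A B i
    rw [hv, mulVec_mulVec, ← pencil_mul_right] at h
    exact h
  refine ⟨of fun r k => (A * minorCoeff A B) r k.succ, ?_, ?_⟩
  · ext r c
    refine Fin.cases ?_ (fun k => ?_) c
    · rw [mul_stdLeft_zero, (key r).1]
    · rw [mul_stdLeft_succ, of_apply]
  · ext r c
    refine Fin.lastCases ?_ (fun k => ?_) c
    · rw [mul_stdRight_last, (key r).2.1]
    · rw [mul_stdRight_castSucc, of_apply, (key r).2.2]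

/-- Every pencil whose maximal minors form a basis of the forms of degree `n` is equivalent
to the standard pencil, by matrices with inverse determinants. -/
lemma exists_mul_mul_eq_std {n : ℕ} (A B : Matrix (Fin n) (Fin (n + 1)) R)
    (h : IsUnit (det (minorCoeff A B))) :
    ∃ (P : Matrix (Fin n) (Fin n) R) (Q : Matrix (Fin (n + 1)) (Fin (n + 1)) R),
      det P * det Q = 1 ∧ P * A * Q = stdLeft R n ∧ P * B * Q = stdRight R n := by
  obtain ⟨K, hA, hB⟩ := exists_mul_minorCoeff_eq_mul_std A B
  set V := minorCoeff A B with hV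
  have hA' : A = K * (stdLeft R n * V⁻¹) := by
    rw [← Matrix.mul_assoc, ← hA, Matrix.mul_nonsing_inv_cancel_right _ _ h]
  have hB' : B = K * (stdRight R n * V⁻¹) := by
    rw [← Matrix.mul_assoc, ← hB, Matrix.mul_nonsing_inv_cancel_right _ _ h]
  have hK : IsUnit (det K) := by
    have h1 := det_minorCoeff_mul_left K (stdLeft R n * V⁻¹) (stdRight R n * V⁻¹)
    rw [← hA', ← hB', ← hV] at h1
    rw [h1] at h
    exact (isUnit_pow_iff n.succ_ne_zero).mp (isUnit_of_mul_isUnit_left h)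
  have hKV : IsUnit (det K⁻¹ * det V) := ((isUnit_nonsing_inv_det_iff).mpr hK).mul h
  obtain ⟨d, hd⟩ := hKV
  refine ⟨(d : R) • K⁻¹, ((d⁻¹ : Rˣ) : R) • V, ?_, ?_, ?_⟩
  · rw [det_smul, det_smul, Fintype.card_fin, Fintype.card_fin]
    calc (d : R) ^ n * det K⁻¹ * (((d⁻¹ : Rˣ) : R) ^ (n + 1) * det V)
        = ((d : R) * ((d⁻¹ : Rˣ) : R)) ^ n * ((d⁻¹ : Rˣ) : R) * (det K⁻¹ * det V) := by ring
      _ = 1 := by rw [← hd]; simp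
  · rw [Matrix.mul_smul, Matrix.smul_mul, Matrix.smul_mul, smul_smul, Matrix.mul_assoc, hA,
      Matrix.nonsing_inv_mul_cancel_left _ _ hK]
    simp
  · rw [Matrix.mul_smul, Matrix.smul_mul, Matrix.smul_mul, smul_smul, Matrix.mul_assoc, hB,
      Matrix.nonsing_inv_mul_cancel_left _ _ hK]
    simp

lemma pencil_std_mulVec (n : ℕ) :
    pencil (stdLeft R n) (stdRight R n) *ᵥ (fun k : Fin (n + 1) => formMonomial R n k) = 0 := by
  ext1 r
  have h : ∀ c : Fin (n + 1), pencil (stdLeft R n) (stdRight R n) r c =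
      (if c = r.succ then X 0 else 0) - (if c = r.castSucc then X 1 else 0) := by
    intro c
    simp only [pencil, stdLeft, stdRight, of_apply]
    split_ifs <;> simp
  simp only [Matrix.mulVec, dotProduct, h, sub_mul, Finset.sum_sub_distrib, ite_mul, zero_mul,
    Finset.sum_ite_eq', Finset.mem_univ, if_true, Pi.zero_apply]
  rw [X_zero_mul_formMonomial (Nat.lt_succ_iff.mp r.succ.2), X_one_mul_formMonomial]
  simp

lemma det_pencil_std_submatrix_succ (n : ℕ) :
    det ((pencil (stdLeft R n) (stdRight R n)).submatrix id Fin.succ) = X 0 ^ n := by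
  rw [det_of_isLowerTriangular]
  · simp [pencil, stdLeft, stdRight, Fin.ext_iff]
  · intro i j hij
    have hij' : (i : ℕ) < j := hij
    have h1 : (j : ℕ) ≠ i := hij'.ne'
    have h2 : (j : ℕ) + 1 ≠ i := by omega
    simp [pencil, stdLeft, stdRight, Fin.ext_iff, h1, h2]

lemma minorVec_std [IsDomain R] (n : ℕ) (i : Fin (n + 1)) :
    minorVec (stdLeft R n) (stdRight R n) i = formMonomial R n i := by
  induction i using Fin.induction with
  | zero =>
    have h : (Fin.succAbove (0 : Fin (n + 1))) = Fin.succ := funext fun _ => by simp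
    rw [minorVec, h, det_pencil_std_submatrix_succ]
    simp [formMonomial]
  | succ i ih =>
    have h1 := congrFun (pencil_mulVec_minorVec (stdLeft R n) (stdRight R n)) i
    have h2 := congrFun (pencil_std_mulVec (R := R) n) i
    have h : ∀ c : Fin (n + 1), pencil (stdLeft R n) (stdRight R n) i c =
        (if c = i.succ then X 0 else 0) - (if c = i.castSucc then X 1 else 0) := by
      intro c
      simp only [pencil, stdLeft, stdRight, of_apply]
      split_ifs <;> simp
    simp only [Matrix.mulVec, dotProduct, h, sub_mul, Finset.sum_sub_distrib, ite_mul, zero_mul,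
      Finset.sum_ite_eq', Finset.mem_univ, if_true, Pi.zero_apply] at h1 h2
    rw [ih] at h1
    refine mul_left_cancel₀ (X_ne_zero (R := R) (0 : Fin 2)) ?_
    linear_combination h1 - h2

lemma minorCoeff_std [IsDomain R] (n : ℕ) :
    minorCoeff (stdLeft R n) (stdRight R n) = 1 := by
  ext i j
  rw [minorCoeff, of_apply, minorVec_std, ← one_mul (formMonomial R n i), ← map_one C,
    C_mul_formMonomial, formCoeff_monomial, Matrix.one_apply]
  exact if_congr Fin.ext_iff.symm rfl rfl

/-- The stabilizer of the standard pencil consists of scalars. -/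
lemma eq_smul_one_of_std_mul_eq {n : ℕ} (H : Matrix (Fin (n + 1)) (Fin (n + 1)) R)
    (K : Matrix (Fin n) (Fin n) R) (hA : stdLeft R n * H = K * stdLeft R n)
    (hB : stdRight R n * H = K * stdRight R n) :
    H = H 0 0 • (1 : Matrix (Fin (n + 1)) (Fin (n + 1)) R) ∧
      K = H 0 0 • (1 : Matrix (Fin n) (Fin n) R) := by
  have h1 : ∀ r : Fin n, H r.succ 0 = 0 := fun r => by
    rw [← stdLeft_mul H, hA, mul_stdLeft_zero]
  have h2 : ∀ r c : Fin n, H r.succ c.succ = K r c := fun r c => by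
    rw [← stdLeft_mul H, hA, mul_stdLeft_succ]
  have h3 : ∀ r : Fin n, H r.castSucc (Fin.last n) = 0 := fun r => by
    rw [← stdRight_mul H, hB, mul_stdRight_last]
  have h4 : ∀ r c : Fin n, H r.castSucc c.castSucc = K r c := fun r c => by
    rw [← stdRight_mul H, hB, mul_stdRight_castSucc]
  have hdiag : ∀ i : Fin (n + 1), H i i = H 0 0 := by
    intro i
    induction i using Fin.induction with
    | zero => rfl
    | succ i ih => rw [h2, ← h4, ih]
  have hlow : ∀ i j : Fin (n + 1), j < i → H i j = 0 := by
    intro i j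
    induction j using Fin.induction generalizing i with
    | zero =>
      intro hi
      obtain ⟨r, rfl⟩ := Fin.exists_succ_eq.mpr hi.ne'
      exact h1 r
    | succ j ih =>
      intro hi
      obtain ⟨r, rfl⟩ := Fin.exists_succ_eq.mpr (Fin.pos_of_ne_zero (Fin.ne_zero_of_lt hi)).ne'
      rw [h2, ← h4]
      exact ih _ (by simpa using hi)
  have hup : ∀ i j : Fin (n + 1), i < j → H i j = 0 := by
    intro i j
    induction j using Fin.reverseInduction generalizing i with
    | last =>
      intro hi
      obtain ⟨r, rfl⟩ := Fin.exists_castSucc_eq.mpr hi.ne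
      exact h3 r
    | cast j ih =>
      intro hi
      obtain ⟨r, rfl⟩ := Fin.exists_castSucc_eq.mpr (hi.trans_le (Fin.le_last _)).ne
      rw [h4, ← h2]
      exact ih _ (by simpa using hi)
  have hH : H = H 0 0 • (1 : Matrix (Fin (n + 1)) (Fin (n + 1)) R) := by
    ext i j
    rcases lt_trichotomy i j with h | h | h
    · simp [hup i j h, h.ne]
    · subst h
      simp [hdiag]
    · simp [hlow i j h, h.ne']
  refine ⟨hH, ?_⟩
  ext r c
  rw [← h2]
  rcases eq_or_ne r c with h | h
  · subst h
    simp [hdiag]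
  · rcases lt_or_gt_of_ne h with h' | h'
    · simp [hup r.succ c.succ (by simpa using h'), h]
    · simp [hlow r.succ c.succ (by simpa using h'), h]

/-! ### Symmetric matrices modulo multiples of the standard pencil -/

lemma mul_stdLeft_apply {n : ℕ} (u : ℕ → ℕ → R) (i j : Fin (n + 1)) :
    ((of fun (i : Fin (n + 1)) (j : Fin n) => u i j) * stdLeft R n) i j =
      if (j : ℕ) = 0 then 0 else u i (j - 1) := by
  refine Fin.cases ?_ (fun k => ?_) j
  · simp [mul_stdLeft_zero]
  · simp [mul_stdLeft_succ]

lemma mul_stdRight_apply {n : ℕ} (u : ℕ → ℕ → R) (i j : Fin (n + 1)) :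
    ((of fun (i : Fin (n + 1)) (j : Fin n) => u i j) * stdRight R n) i j =
      if (j : ℕ) = n then 0 else u i j := by
  refine Fin.lastCases ?_ (fun k => ?_) j
  · simp [mul_stdRight_last]
  · simp [mul_stdRight_castSucc, k.2.ne]

/-- The upper triangular part of the solution to the equations expressing that
adding a multiple of the standard pencil kills given off-diagonal entries. -/
def offDiagSol (n : ℕ) (a b : ℕ → ℕ → R) : ℕ → ℕ → R
  | 0, j => if j < n then a 0 (j + 1) else 0
  | i + 1, j => if j < n then a (i + 1) (j + 1) - (b i (j + 1) - offDiagSol n a b i (j + 1)) else 0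

lemma exists_mul_std_add_transpose {n : ℕ} (S T : Matrix (Fin (n + 1)) (Fin (n + 1)) R) :
    ∃ U : Matrix (Fin (n + 1)) (Fin n) R, ∀ i j : Fin (n + 1), i < j →
      (U * stdLeft R n) i j + (U * stdLeft R n) j i = S i j ∧
      (U * stdRight R n) i j + (U * stdRight R n) j i = T i j := by
  set a : ℕ → ℕ → R := fun i j => S (Fin.ofNat (n + 1) i) (Fin.ofNat (n + 1) j) with ha
  set b : ℕ → ℕ → R := fun i j => T (Fin.ofNat (n + 1) i) (Fin.ofNat (n + 1) j) with hb
  have ha' : ∀ i j : Fin (n + 1), a i j = S i j := fun i j => by simp [ha]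
  have hb' : ∀ i j : Fin (n + 1), b i j = T i j := fun i j => by simp [hb]
  set F := offDiagSol n a b with hF
  have hFn : ∀ i, F i n = 0 := by
    rintro (_ | i) <;> simp [hF, offDiagSol]
  refine ⟨of fun i j => if (i : ℕ) ≤ j then F i j else b j i - F j i, fun i j hij => ?_⟩
  have hij' : (i : ℕ) < j := hij
  have hj : (j : ℕ) ≤ n := Nat.lt_succ_iff.mp j.2
  rw [mul_stdLeft_apply (fun i j => if i ≤ j then F i j else b j i - F j i),
    mul_stdLeft_apply (fun i j => if i ≤ j then F i j else b j i - F j i),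
    mul_stdRight_apply (fun i j => if i ≤ j then F i j else b j i - F j i),
    mul_stdRight_apply (fun i j => if i ≤ j then F i j else b j i - F j i), ← ha', ← hb']
  generalize (i : ℕ) = i at *
  generalize (j : ℕ) = j at *
  obtain ⟨j, rfl⟩ : ∃ k, j = k + 1 := ⟨j - 1, by omega⟩
  constructor
  · rw [if_neg (by omega), if_pos (by omega), Nat.add_sub_cancel]
    rcases i with _ | i
    · rw [if_pos rfl, add_zero, hF, offDiagSol, if_pos (by omega)]
    · rw [if_neg (by omega), if_neg (by omega), Nat.add_sub_cancel, hF, offDiagSol,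
        if_pos (by omega)]
      ring
  · rw [if_neg (show i ≠ n by omega), if_neg (show ¬ j + 1 ≤ i by omega), if_pos hij'.le]
    split_ifs with h
    · rw [h, hFn]
      ring
    · ring

lemma eq_zero_of_mul_std_add_transpose {n : ℕ} (U : Matrix (Fin (n + 1)) (Fin n) R)
    (hL : ∀ i j : Fin (n + 1), i < j → (U * stdLeft R n) i j + (U * stdLeft R n) j i = 0)
    (hR : ∀ i j : Fin (n + 1), i < j → (U * stdRight R n) i j + (U * stdRight R n) j i = 0) :
    U = 0 := by
  have key : ∀ i : Fin (n + 1), (∀ j : Fin n, i ≤ j.castSucc → U i j = 0) ∧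
      ∀ (j : Fin (n + 1)) (k : Fin n), k.castSucc = i → i < j → U j k = 0 := by
    have step : ∀ i : Fin (n + 1), (∀ j : Fin n, i ≤ j.castSucc → U i j = 0) →
        ∀ (j : Fin (n + 1)) (k : Fin n), k.castSucc = i → i < j → U j k = 0 := by
      rintro i h j k rfl hj
      have h1 := hR _ j hj
      rw [mul_stdRight_castSucc] at h1
      revert h1 hj
      refine Fin.lastCases ?_ (fun l => ?_) j
      · rw [mul_stdRight_last, zero_add]
        exact fun _ h => h
      · intro hl
        rw [mul_stdRight_castSucc, h l hl.le, zero_add]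
        exact id
    intro i
    induction i using Fin.induction with
    | zero =>
      have h : ∀ j : Fin n, (0 : Fin (n + 1)) ≤ j.castSucc → U 0 j = 0 := by
        intro j _
        have h1 := hL 0 j.succ (Fin.succ_pos j)
        rwa [mul_stdLeft_succ, mul_stdLeft_zero, add_zero] at h1
      exact ⟨h, step 0 h⟩
    | succ i ih =>
      have h : ∀ j : Fin n, i.succ ≤ j.castSucc → U i.succ j = 0 := by
        intro j hj
        have hj' : (i : ℕ) + 1 ≤ j := by simpa [Fin.le_def] using hj
        have h1 := hL i.succ j.succ (by rw [Fin.lt_def]; simp; omega)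
        rwa [mul_stdLeft_succ, mul_stdLeft_succ,
          ih.2 j.succ i rfl (by rw [Fin.lt_def]; simp; omega), add_zero] at h1
      exact ⟨h, step _ h⟩
  ext i j
  rcases le_or_gt i j.castSucc with h | h
  · exact (key i).1 j h
  · exact (key j.castSucc).2 i j rfl h

end Pencil

/-! ### Block decompositions -/

section Blocks

variable {R : Type*} {n : ℕ}

/-- The splitting of the indices `0, …, 2n` into the first `n` and the last `n+1`. -/
def blockEquiv (n : ℕ) : Fin n ⊕ Fin (n + 1) ≃ Fin (2 * n + 1) :=
  finSumFinEquiv.trans (finCongr (by omega))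

lemma blockEquiv_inl (i : Fin n) : blockEquiv n (Sum.inl i) = rowIdx n i := rfl

lemma blockEquiv_inr (i : Fin (n + 1)) : blockEquiv n (Sum.inr i) = colIdx n i := rfl

lemma rowIdx_lt (i : Fin n) : (rowIdx n i : ℕ) < n := i.2

lemma le_colIdx (i : Fin (n + 1)) : n ≤ (colIdx n i : ℕ) := Nat.le_add_right n i

/-- The block matrix with indices `0, …, 2n` and blocks of sizes `n` and `n+1`. -/
def blockMat (A : Matrix (Fin n) (Fin n) R) (B : Matrix (Fin n) (Fin (n + 1)) R)
    (D : Matrix (Fin (n + 1)) (Fin n) R) (E : Matrix (Fin (n + 1)) (Fin (n + 1)) R) :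
    Matrix (Fin (2 * n + 1)) (Fin (2 * n + 1)) R :=
  (fromBlocks A B D E).submatrix (blockEquiv n).symm (blockEquiv n).symm

lemma eq_blockMat (M : Matrix (Fin (2 * n + 1)) (Fin (2 * n + 1)) R) :
    M = blockMat (M.submatrix (rowIdx n) (rowIdx n)) (M.submatrix (rowIdx n) (colIdx n))
      (M.submatrix (colIdx n) (rowIdx n)) (M.submatrix (colIdx n) (colIdx n)) := by
  ext i j
  obtain ⟨i, rfl⟩ := (blockEquiv n).surjective i
  obtain ⟨j, rfl⟩ := (blockEquiv n).surjective j
  simp only [blockMat, submatrix_apply, Equiv.symm_apply_apply]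
  rcases i with i | i <;> rcases j with j | j <;> rfl

lemma blockMat_inj {A A' : Matrix (Fin n) (Fin n) R} {B B' : Matrix (Fin n) (Fin (n + 1)) R}
    {D D' : Matrix (Fin (n + 1)) (Fin n) R} {E E' : Matrix (Fin (n + 1)) (Fin (n + 1)) R} :
    blockMat A B D E = blockMat A' B' D' E' ↔ A = A' ∧ B = B' ∧ D = D' ∧ E = E' := by
  rw [← fromBlocks_inj]
  exact (reindex (blockEquiv n) (blockEquiv n)).injective.eq_iff

lemma blockMat_transpose (A : Matrix (Fin n) (Fin n) R) (B : Matrix (Fin n) (Fin (n + 1)) R)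
    (D : Matrix (Fin (n + 1)) (Fin n) R) (E : Matrix (Fin (n + 1)) (Fin (n + 1)) R) :
    (blockMat A B D E)ᵀ = blockMat Aᵀ Dᵀ Bᵀ Eᵀ := by
  rw [blockMat, transpose_submatrix, fromBlocks_transpose]
  rfl

lemma blockMat_rowIdx_colIdx (A : Matrix (Fin n) (Fin n) R) (B : Matrix (Fin n) (Fin (n + 1)) R)
    (D : Matrix (Fin (n + 1)) (Fin n) R) (E : Matrix (Fin (n + 1)) (Fin (n + 1)) R)
    (i : Fin n) (j : Fin (n + 1)) : blockMat A B D E (rowIdx n i) (colIdx n j) = B i j := by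
  rw [← blockEquiv_inl, ← blockEquiv_inr]
  simp [blockMat]

variable [CommRing R]

lemma blockMat_mul (A A' : Matrix (Fin n) (Fin n) R) (B B' : Matrix (Fin n) (Fin (n + 1)) R)
    (D D' : Matrix (Fin (n + 1)) (Fin n) R) (E E' : Matrix (Fin (n + 1)) (Fin (n + 1)) R) :
    blockMat A B D E * blockMat A' B' D' E' =
      blockMat (A * A' + B * D') (A * B' + B * E') (D * A' + E * D') (D * B' + E * E') := by
  rw [blockMat, blockMat, submatrix_mul_equiv, fromBlocks_multiply]
  rfl

lemma blockMat_one : blockMat (1 : Matrix (Fin n) (Fin n) R) 0 0 1 = 1 := by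
  rw [blockMat, fromBlocks_one, submatrix_one_equiv]

lemma det_blockMat (A : Matrix (Fin n) (Fin n) R) (D : Matrix (Fin (n + 1)) (Fin n) R)
    (E : Matrix (Fin (n + 1)) (Fin (n + 1)) R) :
    det (blockMat A 0 D E) = det A * det E := by
  rw [blockMat, det_submatrix_equiv_self, det_fromBlocks_zero₁₂]

/-- The pair of block matrices with vanishing top left blocks. -/
def borderPair (A B : Matrix (Fin n) (Fin (n + 1)) R)
    (S T : Matrix (Fin (n + 1)) (Fin (n + 1)) R) : MPair n R :=
  (blockMat 0 A Aᵀ S, blockMat 0 B Bᵀ T)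

lemma exists_eq_borderPair {w : MPair n R} (hw : W0mem n w) :
    ∃ (A B : Matrix (Fin n) (Fin (n + 1)) R) (S T : Matrix (Fin (n + 1)) (Fin (n + 1)) R),
      S.IsSymm ∧ T.IsSymm ∧ w = borderPair A B S T := by
  obtain ⟨⟨h1, h2⟩, h0⟩ := hw
  refine ⟨w.1.submatrix (rowIdx n) (colIdx n), w.2.submatrix (rowIdx n) (colIdx n),
    w.1.submatrix (colIdx n) (colIdx n), w.2.submatrix (colIdx n) (colIdx n),
    h1.submatrix _, h2.submatrix _, Prod.ext ?_ ?_⟩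
  · refine (eq_blockMat w.1).trans (blockMat_inj.mpr ⟨?_, rfl, ?_, rfl⟩)
    · ext i j
      exact (h0 _ _ (rowIdx_lt i) (rowIdx_lt j)).1
    · rw [transpose_submatrix, h1.eq]
  · refine (eq_blockMat w.2).trans (blockMat_inj.mpr ⟨?_, rfl, ?_, rfl⟩)
    · ext i j
      exact (h0 _ _ (rowIdx_lt i) (rowIdx_lt j)).2
    · rw [transpose_submatrix, h2.eq]

lemma W0mem_borderPair (A B : Matrix (Fin n) (Fin (n + 1)) R)
    {S T : Matrix (Fin (n + 1)) (Fin (n + 1)) R} (hS : S.IsSymm) (hT : T.IsSymm) :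
    W0mem n (borderPair A B S T) := by
  have hzero : ∀ (M : Matrix (Fin n) (Fin (n + 1)) R) (U : Matrix (Fin (n + 1)) (Fin (n + 1)) R)
      (i j : Fin (2 * n + 1)), (i : ℕ) < n → (j : ℕ) < n → blockMat 0 M Mᵀ U i j = 0 := by
    intro M U i j hi hj
    have hi' : i = blockEquiv n (Sum.inl ⟨i, hi⟩) := rfl
    have hj' : j = blockEquiv n (Sum.inl ⟨j, hj⟩) := rfl
    rw [hi', hj']
    simp [blockMat]
  refine ⟨⟨?_, ?_⟩, fun i j hi hj => ⟨hzero _ _ i j hi hj, hzero _ _ i j hi hj⟩⟩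
  · simp only [borderPair, Matrix.IsSymm, blockMat_transpose, hS.eq, transpose_zero,
      transpose_transpose]
  · simp only [borderPair, Matrix.IsSymm, blockMat_transpose, hT.eq, transpose_zero,
      transpose_transpose]

lemma GNmem_blockMat {P : Matrix (Fin n) (Fin n) R} (U : Matrix (Fin (n + 1)) (Fin n) R)
    {Q : Matrix (Fin (n + 1)) (Fin (n + 1)) R} (h : det P * det Q = 1) :
    GNmem n (blockMat P 0 U Q) := by
  refine ⟨by rw [det_blockMat, h], fun i j hi hj => ?_⟩
  have hi' : i = blockEquiv n (Sum.inl ⟨i, hi⟩) := rfl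
  have hj' : j = blockEquiv n (Sum.inr ⟨j - n, by omega⟩) := by
    rw [blockEquiv_inr]
    ext
    simp [colIdx]
    omega
  rw [hi', hj']
  simp [blockMat]

lemma exists_eq_blockMat_of_GNmem {g : Matrix (Fin (2 * n + 1)) (Fin (2 * n + 1)) R}
    (hg : GNmem n g) :
    ∃ (P : Matrix (Fin n) (Fin n) R) (U : Matrix (Fin (n + 1)) (Fin n) R)
      (Q : Matrix (Fin (n + 1)) (Fin (n + 1)) R),
      det P * det Q = 1 ∧ g = blockMat P 0 U Q := by
  have h : g = blockMat (g.submatrix (rowIdx n) (rowIdx n)) 0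
      (g.submatrix (colIdx n) (rowIdx n)) (g.submatrix (colIdx n) (colIdx n)) := by
    refine (eq_blockMat g).trans (blockMat_inj.mpr ⟨rfl, ?_, rfl, rfl⟩)
    ext i j
    exact hg.2 _ _ (rowIdx_lt i) (le_colIdx j)
  refine ⟨_, _, _, ?_, h⟩
  rw [← hg.1, ← det_blockMat, ← h]

lemma GNmem.mul {g h : Matrix (Fin (2 * n + 1)) (Fin (2 * n + 1)) R} (hg : GNmem n g)
    (hh : GNmem n h) : GNmem n (g * h) := by
  obtain ⟨P, U, Q, hd, rfl⟩ := exists_eq_blockMat_of_GNmem hg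
  obtain ⟨P', U', Q', hd', rfl⟩ := exists_eq_blockMat_of_GNmem hh
  have : blockMat P 0 U Q * blockMat P' 0 U' Q' =
      blockMat (P * P') 0 (U * P' + Q * U') (Q * Q') := by
    rw [blockMat_mul]
    simp
  rw [this]
  refine GNmem_blockMat _ ?_
  rw [det_mul, det_mul]
  linear_combination (det P' * det Q') * hd + hd'

lemma GNmem.exists_inv {g : Matrix (Fin (2 * n + 1)) (Fin (2 * n + 1)) R} (hg : GNmem n g) :
    ∃ h, GNmem n h ∧ h * g = 1 ∧ g * h = 1 := by
  obtain ⟨P, U, Q, hd, rfl⟩ := exists_eq_blockMat_of_GNmem hg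
  have hP : IsUnit (det P) := IsUnit.of_mul_eq_one _ hd
  have hQ : IsUnit (det Q) := IsUnit.of_mul_eq_one_right _ hd
  have h1 : blockMat P⁻¹ 0 (-(Q⁻¹ * U * P⁻¹)) Q⁻¹ * blockMat P 0 U Q = 1 := by
    rw [blockMat_mul, ← blockMat_one, blockMat_inj]
    refine ⟨?_, ?_, ?_, ?_⟩
    · simp [Matrix.nonsing_inv_mul _ hP]
    · simp
    · rw [Matrix.neg_mul, Matrix.nonsing_inv_mul_cancel_right _ _ hP]
      simp
    · simp [Matrix.nonsing_inv_mul _ hQ]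
  refine ⟨_, GNmem_blockMat _ ?_, h1, mul_eq_one_comm.mp h1⟩
  have hPi : det P⁻¹ * det P = 1 := by
    rw [← det_mul, Matrix.nonsing_inv_mul _ hP, det_one]
  have hQi : det Q⁻¹ * det Q = 1 := by
    rw [← det_mul, Matrix.nonsing_inv_mul _ hQ, det_one]
  calc det P⁻¹ * det Q⁻¹ = det P⁻¹ * det Q⁻¹ * (det P * det Q) := by rw [hd, mul_one]
    _ = (det P⁻¹ * det P) * (det Q⁻¹ * det Q) := by ring
    _ = 1 := by rw [hPi, hQi, mul_one]

lemma actPair_mul {m : ℕ} (g h : Matrix (Fin m) (Fin m) R)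
    (w : Matrix (Fin m) (Fin m) R × Matrix (Fin m) (Fin m) R) :
    actPair (g * h) w = actPair g (actPair h w) := by
  simp [actPair, transpose_mul, Matrix.mul_assoc]

lemma actPair_one {m : ℕ} (w : Matrix (Fin m) (Fin m) R × Matrix (Fin m) (Fin m) R) :
    actPair 1 w = w := by
  simp [actPair]

lemma actPair_blockMat (P : Matrix (Fin n) (Fin n) R) (U : Matrix (Fin (n + 1)) (Fin n) R)
    (Q : Matrix (Fin (n + 1)) (Fin (n + 1)) R) (A B : Matrix (Fin n) (Fin (n + 1)) R)
    (S T : Matrix (Fin (n + 1)) (Fin (n + 1)) R) :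
    actPair (blockMat P 0 U Q) (borderPair A B S T) =
      borderPair (P * A * Qᵀ) (P * B * Qᵀ)
        (U * A * Qᵀ + (U * A * Qᵀ)ᵀ + Q * S * Qᵀ) (U * B * Qᵀ + (U * B * Qᵀ)ᵀ + Q * T * Qᵀ) := by
  have h : ∀ (A : Matrix (Fin n) (Fin (n + 1)) R) (S : Matrix (Fin (n + 1)) (Fin (n + 1)) R),
      blockMat P 0 U Q * blockMat 0 A Aᵀ S * (blockMat P 0 U Q)ᵀ =
        blockMat 0 (P * A * Qᵀ) (P * A * Qᵀ)ᵀ (U * A * Qᵀ + (U * A * Qᵀ)ᵀ + Q * S * Qᵀ) := by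
    intro A S
    rw [blockMat_transpose, blockMat_mul, blockMat_mul, blockMat_inj]
    refine ⟨by simp, by simp, by simp [transpose_mul, Matrix.mul_assoc], ?_⟩
    simp only [transpose_mul, transpose_transpose, Matrix.add_mul, Matrix.mul_zero, zero_add,
      Matrix.mul_assoc]
    abel
  exact Prod.ext (h A S) (h B T)

/-! ### Invariants -/

lemma invForm_eq (w : MPair n R) : invForm n w = (-1) ^ n * det (pencil w.1 w.2) := rfl

lemma invForm_actPair {g : Matrix (Fin (2 * n + 1)) (Fin (2 * n + 1)) R} (hg : det g = 1)
    (w : MPair n R) : invForm n (actPair g w) = invForm n w := by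
  rw [invForm_eq, invForm_eq]
  simp only [actPair]
  rw [pencil_mul_right, pencil_mul_left, det_mul, det_mul, det_constMat, det_constMat,
    det_transpose, hg]
  simp

lemma lambdaInv_borderPair (A B : Matrix (Fin n) (Fin (n + 1)) R)
    (S T : Matrix (Fin (n + 1)) (Fin (n + 1)) R) :
    lambdaInv n (borderPair A B S T) = det (minorCoeff A B) := by
  rw [lambdaInv]
  congr 1
  ext i j
  rw [minorCoeff, of_apply, of_apply, minorVec, formCoeff_C_mul]
  simp only [borderPair, blockMat_rowIdx_colIdx]
  rfl

lemma det_pencil_borderPair (A B : Matrix (Fin n) (Fin (n + 1)) R)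
    (S T : Matrix (Fin (n + 1)) (Fin (n + 1)) R) :
    det (pencil (borderPair A B S T).1 (borderPair A B S T).2) =
      det (fromBlocks 0 (pencil A B) (pencil A B)ᵀ (pencil S T)) := by
  have h : pencil (borderPair A B S T).1 (borderPair A B S T).2 =
      (fromBlocks 0 (pencil A B) (pencil A B)ᵀ (pencil S T)).submatrix
        (blockEquiv n).symm (blockEquiv n).symm := by
    ext1 i j
    obtain ⟨i, rfl⟩ := (blockEquiv n).surjective i
    obtain ⟨j, rfl⟩ := (blockEquiv n).surjective j
    rcases i with i | i <;> rcases j with j | j <;>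
      simp [borderPair, blockMat, pencil]
  rw [h, det_submatrix_equiv_self]

/-- The invariant form of a pair with standard top right blocks. -/
lemma invForm_std [IsDomain R] (S T : Matrix (Fin (n + 1)) (Fin (n + 1)) R) :
    invForm n (borderPair (stdLeft R n) (stdRight R n) S T) =
      (fun k : Fin (n + 1) => formMonomial R n k) ⬝ᵥ
        pencil S T *ᵥ (fun k : Fin (n + 1) => formMonomial R n k) := by
  set v : Fin (n + 1) → MvPolynomial (Fin 2) R := fun k => formMonomial R n k with hv
  set M := pencil (stdLeft R n) (stdRight R n) with hM
  let σ : Fin n ⊕ Unit ≃ Fin (n + 1) :=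
    ((finSuccEquiv n).trans (Equiv.optionEquivSumPUnit (Fin n))).symm
  have hσl : ∀ i, σ (Sum.inl i) = i.succ := fun i => by simp [σ]
  have hσr : σ (Sum.inr ()) = 0 := by simp [σ]
  have hcols : fromCols (M.submatrix id Fin.succ) (M.submatrix id fun _ => 0) =
      M.submatrix id σ := by
    ext1 i j
    rcases j with j | j
    · simp [hσl]
    · simp [hσr]
  have hker : M.submatrix id σ *ᵥ (v ∘ σ) = 0 := by
    rw [submatrix_mulVec_equiv, Function.comp_assoc, Equiv.self_comp_symm]
    exact congrArg (· ∘ id) (pencil_std_mulVec n)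
  have h := sq_mul_det_fromBlocks_zero_fromCols (M.submatrix id Fin.succ)
    (M.submatrix id fun _ => 0) ((pencil S T).submatrix σ σ) (v ∘ σ) (by rw [hcols, hker])
  have hdet : det (fromBlocks 0 (M.submatrix id σ) (M.submatrix id σ)ᵀ
      ((pencil S T).submatrix σ σ)) = det (fromBlocks 0 M Mᵀ (pencil S T)) := by
    rw [← det_submatrix_equiv_self (Equiv.sumCongr (Equiv.refl (Fin n)) σ)]
    congr 1
    ext1 i j
    rcases i with i | i <;> rcases j with j | j <;> rfl
  have hdot : (v ∘ σ) ⬝ᵥ (pencil S T).submatrix σ σ *ᵥ (v ∘ σ) = v ⬝ᵥ pencil S T *ᵥ v := by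
    rw [submatrix_mulVec_equiv, Function.comp_assoc, Equiv.self_comp_symm, Function.comp_id,
      comp_equiv_dotProduct_comp_equiv]
  have hv0 : (v ∘ σ) (Sum.inr ()) = X 0 ^ n := by
    simp [hσr, hv, formMonomial]
  rw [hcols, hdet, hdot, hv0, hM, det_pencil_std_submatrix_succ, Fintype.card_fin] at h
  have hX : ((X 0 : MvPolynomial (Fin 2) R) ^ n) ^ 2 ≠ 0 :=
    pow_ne_zero _ (pow_ne_zero _ (X_ne_zero _))
  rw [invForm_eq, det_pencil_borderPair]
  refine mul_left_cancel₀ hX ?_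
  have hsign : ((-1 : MvPolynomial (Fin 2) R) ^ n) * (-1) ^ n = 1 := by
    rw [← mul_pow]; simp
  linear_combination (-1) ^ n * h + (X 0 ^ n) ^ 2 * (v ⬝ᵥ pencil S T *ᵥ v) * hsign

/-- The invariant form of a pair with standard top right blocks and diagonal bottom right
blocks. -/
lemma invForm_std_diagonal [IsDomain R] (a b : Fin (n + 1) → R) :
    invForm n (borderPair (stdLeft R n) (stdRight R n) (diagonal a) (diagonal b)) =
      ∑ i : Fin (n + 1), (C (a i) * formMonomial R (2 * n + 1) (2 * i) -
        C (b i) * formMonomial R (2 * n + 1) (2 * i + 1)) := by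
  have hp : pencil (diagonal a) (diagonal b) =
      diagonal fun i => X 0 * C (a i) - X 1 * C (b i) := by
    ext1 i j
    rcases eq_or_ne i j with rfl | h
    · simp [pencil]
    · simp [pencil, h]
  rw [invForm_std, hp]
  simp only [dotProduct, mulVec_diagonal]
  refine Finset.sum_congr rfl fun i _ => ?_
  have hi : (i : ℕ) ≤ n := Nat.lt_succ_iff.mp i.2
  have hsq : formMonomial R n i * formMonomial R n i = formMonomial R (2 * n) (2 * i) := by
    simp only [formMonomial]
    rw [mul_mul_mul_comm, ← pow_add, ← pow_add, ← two_mul, ← two_mul, Nat.mul_sub]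
  rw [← X_zero_mul_formMonomial (by omega), ← X_one_mul_formMonomial, ← hsq]
  ring

lemma formCoeff_invForm_std_diagonal [IsDomain R] (a b : Fin (n + 1) → R) (i : Fin (n + 1)) :
    formCoeff (invForm n (borderPair (stdLeft R n) (stdRight R n) (diagonal a) (diagonal b)))
      (2 * n + 1) (2 * i) = a i ∧
    formCoeff (invForm n (borderPair (stdLeft R n) (stdRight R n) (diagonal a) (diagonal b)))
      (2 * n + 1) (2 * i + 1) = -b i := by
  simp only [invForm_std_diagonal, formCoeff_sum, formCoeff_sub, C_mul_formMonomial,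
    formCoeff_monomial]
  constructor
  · rw [Finset.sum_eq_single i]
    · simp
    · intro j _ hj
      rw [if_neg fun h => hj (Fin.ext (by omega)), if_neg (by omega), sub_zero]
    · simp
  · rw [Finset.sum_eq_single i]
    · simp
    · intro j _ hj
      rw [if_neg (by omega), if_neg fun h => hj (Fin.ext (by omega)), sub_zero]
    · simp

/-! ### The canonical representative -/

/-- The canonical pair with invariant form `f` and `λ`-invariant one. -/
noncomputable def canonicalPair (n : ℕ) (f : MvPolynomial (Fin 2) R) : MPair n R :=
  borderPair (stdLeft R n) (stdRight R n)
    (diagonal fun i => formCoeff f (2 * n + 1) (2 * i))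
    (diagonal fun i => -formCoeff f (2 * n + 1) (2 * i + 1))

lemma W0mem_canonicalPair (f : MvPolynomial (Fin 2) R) : W0mem n (canonicalPair n f) :=
  W0mem_borderPair _ _ (isSymm_diagonal _) (isSymm_diagonal _)

lemma invForm_canonicalPair [IsDomain R] {f : MvPolynomial (Fin 2) R}
    (hf : f.IsHomogeneous (2 * n + 1)) : invForm n (canonicalPair n f) = f := by
  refine form_ext ?_ hf fun k hk => ?_
  · rw [canonicalPair, invForm_std_diagonal]
    have hC : ∀ (c : R) (k : ℕ), k ≤ 2 * n + 1 →
        (C c * formMonomial R (2 * n + 1) k).IsHomogeneous (2 * n + 1) := fun c k hk => by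
      have := (isHomogeneous_C (Fin 2) c).mul (formMonomial_isHomogeneous (R := R) hk)
      rwa [zero_add] at this
    refine IsHomogeneous.sum _ _ _ fun i _ => (hC _ _ ?_).sub (hC _ _ ?_) <;> omega
  · obtain ⟨j, rfl | rfl⟩ := Nat.even_or_odd' k
    · exact (formCoeff_invForm_std_diagonal _ _ (⟨j, by omega⟩ : Fin (n + 1))).1
    · refine (formCoeff_invForm_std_diagonal _ _ (⟨j, by omega⟩ : Fin (n + 1))).2.trans ?_
      rw [neg_neg]

lemma lambdaInv_canonicalPair [IsDomain R] (f : MvPolynomial (Fin 2) R) :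
    lambdaInv n (canonicalPair n f) = 1 := by
  rw [canonicalPair, lambdaInv_borderPair, minorCoeff_std, det_one]

/-- Every pair whose `λ`-invariant is a unit is equivalent to a canonical pair. -/
lemma exists_actPair_eq_canonicalPair [IsDomain R] {w : MPair n R} (hw : W0mem n w)
    (hl : IsUnit (lambdaInv n w)) :
    ∃ g, GNmem n g ∧ actPair g w = canonicalPair n (invForm n w) := by
  obtain ⟨A, B, S, T, hS, hT, rfl⟩ := exists_eq_borderPair hw
  rw [lambdaInv_borderPair] at hl
  obtain ⟨P, Q, hPQ, hA, hB⟩ := exists_mul_mul_eq_std A B hl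
  have hg₁ : GNmem n (blockMat P 0 0 Qᵀ) := GNmem_blockMat _ (by rw [det_transpose, hPQ])
  set S' := Qᵀ * S * Q with hS'
  set T' := Qᵀ * T * Q with hT'
  have hS's : S'.IsSymm := by
    simp [Matrix.IsSymm, hS', transpose_mul, hS.eq, Matrix.mul_assoc]
  have hT's : T'.IsSymm := by
    simp [Matrix.IsSymm, hT', transpose_mul, hT.eq, Matrix.mul_assoc]
  have hact₁ : actPair (blockMat P 0 0 Qᵀ) (borderPair A B S T) =
      borderPair (stdLeft R n) (stdRight R n) S' T' := by
    rw [actPair_blockMat, transpose_transpose, hA, hB]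
    simp [hS', hT']
  obtain ⟨U, hU⟩ := exists_mul_std_add_transpose (-S') (-T')
  have hg₂ : GNmem n (blockMat 1 0 U (1 : Matrix (Fin (n + 1)) (Fin (n + 1)) R)) :=
    GNmem_blockMat _ (by simp)
  have hdiag : ∀ (L : Matrix (Fin n) (Fin (n + 1)) R) (Z : Matrix (Fin (n + 1)) (Fin (n + 1)) R),
      Z.IsSymm → (∀ i j, i < j → (U * L) i j + (U * L) j i = (-Z) i j) →
      U * L + (U * L)ᵀ + Z = diagonal fun i => (U * L + (U * L)ᵀ + Z) i i := by
    intro L Z hZ h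
    ext i j
    rcases lt_trichotomy i j with hij | rfl | hij
    · have h1 := h i j hij
      rw [Matrix.neg_apply] at h1
      rw [diagonal_apply_ne _ hij.ne, Matrix.add_apply, Matrix.add_apply, transpose_apply, h1,
        neg_add_cancel]
    · rw [diagonal_apply_eq]
    · have h1 := h j i hij
      rw [Matrix.neg_apply, hZ.apply] at h1
      rw [diagonal_apply_ne _ hij.ne', Matrix.add_apply, Matrix.add_apply, transpose_apply,
        add_comm ((U * L) i j), h1, neg_add_cancel]
  have hact₂ : actPair (blockMat 1 0 U 1) (borderPair (stdLeft R n) (stdRight R n) S' T') =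
      borderPair (stdLeft R n) (stdRight R n)
        (diagonal fun i => (U * stdLeft R n + (U * stdLeft R n)ᵀ + S') i i)
        (diagonal fun i => (U * stdRight R n + (U * stdRight R n)ᵀ + T') i i) := by
    rw [actPair_blockMat, ← hdiag _ _ hS's fun i j hij => (hU i j hij).1,
      ← hdiag _ _ hT's fun i j hij => (hU i j hij).2]
    simp
  refine ⟨_, hg₂.mul hg₁, ?_⟩
  have hinv := (invForm_actPair (hg₂.mul hg₁).1 (borderPair A B S T)).symm
  rw [actPair_mul, hact₁, hact₂] at hinv
  rw [actPair_mul, hact₁, hact₂, hinv, canonicalPair]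
  congr 2 <;> ext i
  · rw [(formCoeff_invForm_std_diagonal _ _ i).1]
  · rw [(formCoeff_invForm_std_diagonal _ _ i).2, neg_neg]

/-- The stabilizer of a pair with standard top right blocks is trivial. -/
lemma eq_one_of_actPair_std_eq [IsDomain R] {g : Matrix (Fin (2 * n + 1)) (Fin (2 * n + 1)) R}
    (hg : GNmem n g) {S T : Matrix (Fin (n + 1)) (Fin (n + 1)) R}
    (h : actPair g (borderPair (stdLeft R n) (stdRight R n) S T) =
      borderPair (stdLeft R n) (stdRight R n) S T) : g = 1 := by
  obtain ⟨P, U, Q, hd, rfl⟩ := exists_eq_blockMat_of_GNmem hg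
  rw [actPair_blockMat] at h
  obtain ⟨-, hA, -, hS⟩ := blockMat_inj.mp (congrArg Prod.fst h)
  obtain ⟨-, hB, -, hT⟩ := blockMat_inj.mp (congrArg Prod.snd h)
  have hP : IsUnit (det P) := IsUnit.of_mul_eq_one _ hd
  have hA' : stdLeft R n * Qᵀ = P⁻¹ * stdLeft R n :=
    calc stdLeft R n * Qᵀ = P⁻¹ * (P * (stdLeft R n * Qᵀ)) :=
          (Matrix.nonsing_inv_mul_cancel_left _ _ hP).symm
      _ = P⁻¹ * stdLeft R n := by rw [← Matrix.mul_assoc P, hA]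
  have hB' : stdRight R n * Qᵀ = P⁻¹ * stdRight R n :=
    calc stdRight R n * Qᵀ = P⁻¹ * (P * (stdRight R n * Qᵀ)) :=
          (Matrix.nonsing_inv_mul_cancel_left _ _ hP).symm
      _ = P⁻¹ * stdRight R n := by rw [← Matrix.mul_assoc P, hB]
  obtain ⟨hQ, hPi⟩ := eq_smul_one_of_std_mul_eq _ _ hA' hB'
  set c := Qᵀ 0 0
  have hc : c = 1 := by
    have h1 : det P * det P⁻¹ = 1 := by
      rw [← det_mul, Matrix.mul_nonsing_inv _ hP, det_one]
    have h2 : det Q = c ^ (n + 1) := by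
      rw [← det_transpose, hQ, det_smul, det_one, mul_one, Fintype.card_fin]
    have h3 : det P⁻¹ = c ^ n := by
      rw [hPi, det_smul, det_one, mul_one, Fintype.card_fin]
    rw [h2, pow_succ] at hd
    rw [h3] at h1
    linear_combination hd - c * h1
  rw [hc, one_smul] at hQ hPi
  have hQ1 : Q = 1 := by rw [← transpose_transpose Q, hQ, transpose_one]
  have hP1 : P = 1 := by rw [← Matrix.nonsing_inv_nonsing_inv P hP, hPi, inv_one]
  subst hQ1 hP1
  simp only [transpose_one, Matrix.mul_one, Matrix.one_mul, add_eq_right] at hS hT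
  have hU : U = 0 :=
    eq_zero_of_mul_std_add_transpose U
      (fun i j _ => congrFun (congrFun hS i) j)
      (fun i j _ => congrFun (congrFun hT i) j)
  rw [hU, blockMat_one]

end Blocks

/-- **`G_N(ℤ_p)` acts simply transitively on unit-`λ` loci of fibers of `inv`.**
Let `p` be a prime and `f` a binary `N`-ic form over `ℤ_p` with nonzero discriminant
(equivalently: homogeneous of degree `N` and squarefree over `ℚ_p`).  Then
`{(A,B) ∈ W_N^0(ℤ_p) : inv(A,B) = f, λ(A,B) ∈ ℤ_p^×}` is nonempty, `G_N(ℤ_p)` acts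
transitively on it, and all stabilizers are trivial. -/
theorem GN_Zp_simply_transitive_on_unit_lambda (n : ℕ) (hn : 1 ≤ n)
    (p : ℕ) [Fact p.Prime] (f : MvPolynomial (Fin 2) ℤ_[p])
    (hhom : f.IsHomogeneous (2*n+1))
    (hsf : Squarefree (MvPolynomial.map (PadicInt.Coe.ringHom (p := p)) f)) :
    (∃ w : MPair n ℤ_[p], W0mem n w ∧ invForm n w = f ∧ IsUnit (lambdaInv n w)) ∧
    (∀ w w' : MPair n ℤ_[p], W0mem n w → W0mem n w' →
        invForm n w = f → invForm n w' = f →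
        IsUnit (lambdaInv n w) → IsUnit (lambdaInv n w') →
        ∃ g : Matrix (Fin (2*n+1)) (Fin (2*n+1)) ℤ_[p], GNmem n g ∧ actPair g w = w') ∧
    (∀ (g : Matrix (Fin (2*n+1)) (Fin (2*n+1)) ℤ_[p]) (w : MPair n ℤ_[p]),
        GNmem n g → W0mem n w → invForm n w = f → IsUnit (lambdaInv n w) →
        actPair g w = w → g = 1) := by
  refine ⟨⟨canonicalPair n f, W0mem_canonicalPair f, invForm_canonicalPair hhom, ?_⟩, ?_, ?_⟩
  · rw [lambdaInv_canonicalPair]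
    exact isUnit_one
  · intro w w' hw hw' hf hf' hl hl'
    obtain ⟨g, hg, hgw⟩ := exists_actPair_eq_canonicalPair hw hl
    obtain ⟨g', hg', hgw'⟩ := exists_actPair_eq_canonicalPair hw' hl'
    obtain ⟨k, hk, hkg, -⟩ := hg'.exists_inv
    refine ⟨k * g, hk.mul hg, ?_⟩
    rw [actPair_mul, hgw, hf, ← hf', ← hgw', ← actPair_mul, hkg, actPair_one]
  · intro g w hg hw hf hl hgw
    obtain ⟨h, hh, hhw⟩ := exists_actPair_eq_canonicalPair hw hl
    obtain ⟨k, hk, hkh, hhk⟩ := hh.exists_inv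
    have h1 : actPair (h * g * k) (canonicalPair n (invForm n w)) =
        canonicalPair n (invForm n w) := by
      rw [← hhw, ← actPair_mul, Matrix.mul_assoc, hkh, Matrix.mul_one, actPair_mul, hgw]
    have h2 : h * g * k = 1 := eq_one_of_actPair_std_eq ((hh.mul hg).mul hk) h1
    calc g = k * h * g * (k * h) := by rw [hkh, Matrix.one_mul, Matrix.mul_one]
      _ = k * (h * g * k) * h := by simp only [Matrix.mul_assoc]
      _ = 1 := by rw [h2, Matrix.mul_one, hkh]
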